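/- arXiv:math/9908076 — 2 statements merged into one kernel-verified Lean document; each statement's English description precedes it below -/
import Mathlib

section
/- If X is a nonempty compact Hausdorff space which is an AE(4)-compactum, then for every point x ∈ X the third homotopy group π₃(X, x) is trivial. -/
open Topology

universe u

/-- A topological space `Z` has Lebesgue covering dimension at most `n`:
every finite open cover admits a finite open refinement in which each point
lies in at most `n + 1` members. -/
def CovDimLE (Z : Type u) [TopologicalSpace Z] (n : ℕ) : Prop :=
  ∀ 𝒰 : Finset (Set Z), (∀ U ∈ 𝒰, IsOpen U) → ⋃₀ (𝒰 : Set (Set Z)) = Set.univ →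
    ∃ 𝒱 : Finset (Set Z), (∀ V ∈ 𝒱, IsOpen V) ∧ ⋃₀ (𝒱 : Set (Set Z)) = Set.univ ∧
      (∀ V ∈ 𝒱, ∃ U ∈ 𝒰, V ⊆ U) ∧
      ∀ z : Z, Nat.card {V : Set Z // V ∈ 𝒱 ∧ z ∈ V} ≤ n + 1

/-- `X` is an absolute extensor in dimension `n` (an AE(n)-space): every continuous map
into `X` from a closed subspace of a compact Hausdorff space of covering dimension
at most `n` extends continuously over the whole space. -/
def IsAE (n : ℕ) (X : Type u) [TopologicalSpace X] : Prop :=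
  ∀ (Z : Type u) [TopologicalSpace Z], CompactSpace Z → T2Space Z → CovDimLE Z n →
    ∀ Z₀ : Set Z, IsClosed Z₀ → ∀ g₀ : C(Z₀, X),
      ∃ g : C(Z, X), ∀ z : Z₀, g (z : Z) = g₀ z

/-- `X` is an absolute neighborhood extensor in dimension `4` (an ANE(4)-space):
every continuous map into `X` from a closed subspace `Z₀` of a compact Hausdorff
space of covering dimension at most `4` extends continuously over some open
neighborhood of `Z₀`. -/
def IsANE4 (X : Type u) [TopologicalSpace X] : Prop :=
  ∀ (Z : Type u) [TopologicalSpace Z], CompactSpace Z → T2Space Z → CovDimLE Z 4 →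
    ∀ Z₀ : Set Z, IsClosed Z₀ → ∀ g₀ : C(Z₀, X),
      ∃ (U : Set Z) (_ : IsOpen U) (hZ₀U : Z₀ ⊆ U) (g : C(U, X)),
        ∀ (z : Z) (hz : z ∈ Z₀), g ⟨z, hZ₀U hz⟩ = g₀ ⟨z, hz⟩

/-- The underlying space of `X` is a topological manifold: every point has an open
neighborhood homeomorphic to an open subset of some Euclidean space. -/
def IsTopManifold (X : Type u) [TopologicalSpace X] : Prop :=
  ∀ x : X, ∃ (n : ℕ) (U : Set X) (V : Set (EuclideanSpace ℝ (Fin n))),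
    IsOpen U ∧ x ∈ U ∧ IsOpen V ∧ Nonempty (U ≃ₜ V)

/-- The multiplicative equivalence `e` is an isomorphism of topological groups,
i.e. it is continuous with continuous inverse. -/
def IsTopGroupIso {G H : Type*} [Group G] [Group H] [TopologicalSpace G]
    [TopologicalSpace H] (e : G ≃* H) : Prop :=
  Continuous e ∧ Continuous e.symm

/-- A package consisting of a compact Hausdorff topological group. -/
structure CompactGroupPkg : Type (u + 1) where
  carrier : Type u
  [topology : TopologicalSpace carrier]
  [group : Group carrier]
  [topGroup : IsTopologicalGroup carrier]
  [compact : CompactSpace carrier]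
  [t2 : T2Space carrier]

attribute [instance] CompactGroupPkg.topology CompactGroupPkg.group
  CompactGroupPkg.topGroup CompactGroupPkg.compact CompactGroupPkg.t2

/-- `L` is a simple, connected and simply connected compact Lie group: a compact
Hausdorff topological group whose underlying space is a topological manifold,
which is connected, simply connected, nonabelian, and all of whose closed
normal subgroups other than the whole group are finite. -/
def IsSimpleSCSCLieGroup (L : CompactGroupPkg.{u}) : Prop :=
  IsTopManifold L.carrier ∧ ConnectedSpace L.carrier ∧ SimplyConnectedSpace L.carrier ∧
    (∃ a b : L.carrier, a * b ≠ b * a) ∧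
    ∀ N : Subgroup L.carrier, N.Normal → IsClosed (N : Set L.carrier) → N ≠ ⊤ → Finite N

open scoped unitInterval

/-- The open box with index `p = (c, k)`, in the grid of mesh `1 / M` whose walls are shifted by
`c / (n + 1)`. Boxes of the same colour `c` are pairwise disjoint. -/
def shiftedBox (n : ℕ) (M : ℝ) (p : Fin (n + 1) × (Fin n → ℤ)) : Set (ULift.{u} (Fin n → I)) :=
  {z | ∀ i, (p.2 i : ℝ) < M * (z.down i : ℝ) - (p.1 : ℕ) / ((n : ℝ) + 1) ∧
    M * (z.down i : ℝ) - (p.1 : ℕ) / ((n : ℝ) + 1) < p.2 i + 1}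

theorem isOpen_shiftedBox (n : ℕ) (M : ℝ) (p : Fin (n + 1) × (Fin n → ℤ)) :
    IsOpen (shiftedBox.{u} n M p) := by
  have hc (i : Fin n) : Continuous fun z : ULift.{u} (Fin n → I) ↦
      M * (z.down i : ℝ) - (p.1 : ℕ) / ((n : ℝ) + 1) := by
    have : Continuous fun z : ULift.{u} (Fin n → I) ↦ z.down i :=
      (continuous_apply i).comp continuous_uliftDown
    fun_prop
  simp only [shiftedBox, Set.ofPred_forall]
  exact isOpen_iInter_of_finite fun i ↦
    (isOpen_lt continuous_const (hc i)).inter (isOpen_lt (hc i) continuous_const)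

/-- A real number lies on the walls of at most one of the `n + 1` shifted grids. -/
theorem eq_of_sub_div_eq_intCast {n : ℕ} {t : ℝ} {c d : Fin (n + 1)} {k l : ℤ}
    (hk : t - (c : ℕ) / ((n : ℝ) + 1) = k) (hl : t - (d : ℕ) / ((n : ℝ) + 1) = l) : c = d := by
  have hn : (n : ℝ) + 1 ≠ 0 := by positivity
  have h : ((d : ℕ) : ℝ) - (c : ℕ) = (k - l) * ((n : ℝ) + 1) := by
    rw [← hk, ← hl]
    field_simp
    ring
  have h' : ((d : ℕ) : ℤ) - (c : ℕ) = ((n + 1 : ℕ) : ℤ) * (k - l) := by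
    rw [mul_comm]
    exact_mod_cast h
  have h0 := Int.eq_zero_of_abs_lt_dvd (Dvd.intro _ h'.symm) (by rw [abs_lt]; omega)
  ext
  omega

theorem exists_mem_shiftedBox (n : ℕ) (M : ℝ) (z : ULift.{u} (Fin n → I)) :
    ∃ p, z ∈ shiftedBox n M p := by
  obtain ⟨c, hc⟩ : ∃ c : Fin (n + 1), ∀ (i : Fin n) (k : ℤ),
      M * (z.down i : ℝ) - (c : ℕ) / ((n : ℝ) + 1) ≠ k := by
    by_contra! hwall
    choose i k hik using hwall
    obtain ⟨c, d, hcd, heq⟩ := Fintype.exists_ne_map_eq_of_card_lt i (by simp)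
    exact hcd (eq_of_sub_div_eq_intCast (hik c) (heq ▸ hik d))
  exact ⟨(c, fun i ↦ ⌊M * (z.down i : ℝ) - (c : ℕ) / ((n : ℝ) + 1)⌋), fun i ↦
    ⟨(Int.floor_le _).lt_of_ne (hc i _).symm, Int.lt_floor_add_one _⟩⟩

theorem eq_of_mem_shiftedBox {n : ℕ} {M : ℝ} {z : ULift.{u} (Fin n → I)}
    {p q : Fin (n + 1) × (Fin n → ℤ)} (hp : z ∈ shiftedBox n M p) (hq : z ∈ shiftedBox n M q)
    (h : p.1 = q.1) : p = q := by
  refine Prod.ext h (funext fun i ↦ ?_)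
  have h₁ := hp i
  have h₂ := hq i
  rw [h] at h₁
  have h₃ : (p.2 i : ℝ) < q.2 i + 1 := h₁.1.trans h₂.2
  have h₄ : (q.2 i : ℝ) < p.2 i + 1 := h₂.1.trans h₁.2
  norm_cast at h₃ h₄
  omega

theorem shiftedBox_subset_ball {n : ℕ} {M δ : ℝ} (hM : 0 < M) (hδ : 0 < δ) (hMδ : 1 ≤ M * δ)
    {p : Fin (n + 1) × (Fin n → ℤ)} {z : ULift.{u} (Fin n → I)} (hz : z ∈ shiftedBox n M p) :
    shiftedBox n M p ⊆ Metric.ball z δ := by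
  intro y hy
  rw [Metric.mem_ball, ULift.dist_eq, dist_pi_lt_iff hδ]
  intro i
  rw [Subtype.dist_eq, Real.dist_eq, abs_lt]
  have h₁ := hy i
  have h₂ := hz i
  constructor <;> refine lt_of_mul_lt_mul_left ?_ hM.le <;> linarith

theorem covDimLE_cube (n : ℕ) : CovDimLE (ULift.{u} (Fin n → I)) n := by
  classical
  intro 𝒰 hopen hcov
  obtain ⟨δ, hδ, hball⟩ := lebesgue_number_lemma_of_metric_sUnion isCompact_univ
    (c := (𝒰 : Set (Set (ULift.{u} (Fin n → I))))) (by simpa using hopen) hcov.ge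
  obtain ⟨t, ht⟩ := isCompact_univ.elim_finite_subcover (shiftedBox.{u} n δ⁻¹)
    (isOpen_shiftedBox n δ⁻¹) fun z _ ↦ Set.mem_iUnion.2 (exists_mem_shiftedBox n δ⁻¹ z)
  refine ⟨t.image (shiftedBox n δ⁻¹), ?_, ?_, ?_, fun z ↦ ?_⟩
  · simp only [Finset.mem_image]
    rintro _ ⟨p, -, rfl⟩
    exact isOpen_shiftedBox n δ⁻¹ p
  · rw [Finset.coe_image, Set.sUnion_image]
    exact Set.univ_subset_iff.1 ht
  · simp only [Finset.mem_image]
    rintro _ ⟨p, -, rfl⟩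
    rcases (shiftedBox.{u} n δ⁻¹ p).eq_empty_or_nonempty with he | ⟨z, hz⟩
    · obtain ⟨U, hU, -⟩ := hball ⟨fun _ ↦ 0⟩ trivial
      exact ⟨U, hU, he ▸ Set.empty_subset U⟩
    · obtain ⟨U, hU, hzU⟩ := hball z trivial
      exact ⟨U, hU, (shiftedBox_subset_ball (inv_pos.2 hδ) hδ
        (inv_mul_cancel₀ hδ.ne').ge hz).trans hzU⟩
  · have hidx (V : {V // V ∈ t.image (shiftedBox.{u} n δ⁻¹) ∧ z ∈ V}) :
        ∃ p, shiftedBox n δ⁻¹ p = V.1 :=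
      (Finset.mem_image.1 V.2.1).imp fun _ hp ↦ hp.2
    choose p hp using hidx
    have hinj : Function.Injective fun V ↦ (p V).1 := fun V W hVW ↦ by
      have hpq := eq_of_mem_shiftedBox ((hp V).symm ▸ V.2.2) ((hp W).symm ▸ W.2.2) hVW
      exact Subtype.ext ((hp V).symm.trans (hpq ▸ hp W))
    simpa using Nat.card_le_card_of_injective _ hinj

/-- In an `AE(n + 1)`-space any two `n`-dimensional loops are homotopic. -/
theorem IsAE.genLoop_homotopic {n : ℕ} {X : Type u} [TopologicalSpace X] (h : IsAE (n + 1) X)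
    {x : X} (f g : GenLoop (Fin n) X x) : GenLoop.Homotopic f g := by
  classical
  let hd (z : ULift.{u} (Fin (n + 1) → I)) : I := z.down 0
  let tl (z : ULift.{u} (Fin (n + 1) → I)) : Fin n → I := Fin.tail z.down
  have hhd : Continuous hd := (continuous_apply 0).comp continuous_uliftDown
  have htl : Continuous tl :=
    continuous_pi fun i ↦ (continuous_apply i.succ).comp continuous_uliftDown
  have hbdry : IsClosed (Cube.boundary (Fin n)) := by
    simp only [Cube.boundary, Set.ofPred_exists]
    exact isClosed_iUnion_of_finite fun i ↦
      (isClosed_eq (continuous_apply i) continuous_const).union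
        (isClosed_eq (continuous_apply i) continuous_const)
  let F (z : ULift.{u} (Fin (n + 1) → I)) : X :=
    if hd z = 0 then f (tl z) else if hd z = 1 then g (tl z) else x
  have hA : IsClosed (hd ⁻¹' {0}) := isClosed_singleton.preimage hhd
  have hB : IsClosed (hd ⁻¹' {1}) := isClosed_singleton.preimage hhd
  have hC : IsClosed (tl ⁻¹' Cube.boundary (Fin n)) := hbdry.preimage htl
  have hF₀ (z) (hz : hd z = 0) : F z = f (tl z) := if_pos hz
  have hF₁ (z) (hz : hd z = 1) : F z = g (tl z) := by simp [F, hz]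
  have hFx (z) (hz : tl z ∈ Cube.boundary (Fin n)) : F z = x := by
    have hf : f (tl z) = x := f.2 _ hz
    have hg : g (tl z) = x := g.2 _ hz
    simp [F, hf, hg]
  have hFA : ContinuousOn F (hd ⁻¹' {0}) :=
    (f.1.continuous.comp htl).continuousOn.congr hF₀
  have hFB : ContinuousOn F (hd ⁻¹' {1}) :=
    (g.1.continuous.comp htl).continuousOn.congr hF₁
  have hFC : ContinuousOn F (tl ⁻¹' Cube.boundary (Fin n)) := continuousOn_const.congr hFx
  have hF := (hFA.union_of_isClosed hFB hA hB).union_of_isClosed hFC (hA.union hB) hC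
  obtain ⟨G, hG⟩ := h (ULift.{u} (Fin (n + 1) → I)) inferInstance inferInstance
    (covDimLE_cube (n + 1)) _ ((hA.union hB).union hC) ⟨_, hF.domRestrict⟩
  have hG' (z) (hz : z ∈ hd ⁻¹' {0} ∪ hd ⁻¹' {1} ∪ tl ⁻¹' Cube.boundary (Fin n)) :
      G z = F z := hG ⟨z, hz⟩
  let e (p : I × (Fin n → I)) : ULift.{u} (Fin (n + 1) → I) := ⟨Fin.cons p.1 p.2⟩
  have he : Continuous e := by
    refine continuous_uliftUp.comp (continuous_pi fun i ↦ ?_)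
    refine Fin.cases ?_ (fun i ↦ ?_) i
    · simpa using continuous_fst
    · simpa [Function.comp_def] using (continuous_apply i).comp continuous_snd
  refine ⟨⟨⟨⟨fun p ↦ G (e p), G.continuous.comp he⟩, fun y ↦ ?_, fun y ↦ ?_⟩, fun t y hy ↦ ?_⟩⟩
  · exact (hG' (e (0, y)) (Or.inl (Or.inl rfl))).trans (hF₀ (e (0, y)) rfl)
  · exact (hG' (e (1, y)) (Or.inl (Or.inr rfl))).trans (hF₁ (e (1, y)) rfl)
  · exact ((hG' (e (t, y)) (Or.inr hy)).trans (hFx (e (t, y)) hy)).trans (f.2 y hy).symm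

/-- If `X` is a nonempty compact Hausdorff AE(4)-compactum, then for every point
`x ∈ X` the third homotopy group `π₃(X, x)` is trivial. -/
theorem pi3_trivial_of_AE4 (X : Type u) [TopologicalSpace X] [CompactSpace X]
    [T2Space X] [Nonempty X] (h : IsAE 4 X) (x : X) :
    ∀ a b : π_ 3 X x, a = b := by
  intro a b
  induction a using Quotient.inductionOn with
  | h f =>
    induction b using Quotient.inductionOn with
    | h g => exact Quotient.sound (h.genLoop_homotopic f g)
end

section
/- Every nonempty compact Hausdorff space which is an AE(2)-compactum is simply connected, i.e. path-connected with trivial fundamental group. -/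
open Topology

universe u

open unitInterval

/-- The square of side `1 / N` with lower left corner `((i + k / 3) / N, (j + k / 3) / N)`,
as an open subset of the unit square. -/
def shiftedCell (N : ℕ) (k : Fin 3) (i j : ℤ) : Set (ULift.{u} (I × I)) :=
  {z | (N : ℝ) * z.down.1 - (k : ℕ) / 3 ∈ Set.Ioo (i : ℝ) (i + 1) ∧
    (N : ℝ) * z.down.2 - (k : ℕ) / 3 ∈ Set.Ioo (j : ℝ) (j + 1)}

theorem isOpen_shiftedCell (N : ℕ) (k : Fin 3) (i j : ℤ) :
    IsOpen (shiftedCell.{u} N k i j) :=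
  (isOpen_Ioo.preimage (by fun_prop)).inter (isOpen_Ioo.preimage (by fun_prop))

theorem abs_sub_lt_of_mem_Ioo {N : ℕ} {δ c i a b : ℝ} (hδ : 1 < N * δ)
    (ha : N * a - c ∈ Set.Ioo i (i + 1)) (hb : N * b - c ∈ Set.Ioo i (i + 1)) :
    |a - b| < δ := by
  have hN : (0 : ℝ) ≤ N := Nat.cast_nonneg N
  obtain ⟨ha₁, ha₂⟩ := ha
  obtain ⟨hb₁, hb₂⟩ := hb
  rw [abs_lt]
  constructor
  · refine lt_of_mul_lt_mul_left (a := (N : ℝ)) ?_ hN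
    linarith
  · refine lt_of_mul_lt_mul_left (a := (N : ℝ)) ?_ hN
    linarith

theorem shiftedCell_subset_ball {N : ℕ} {δ : ℝ} (hδ : 1 < N * δ) {k : Fin 3} {i j : ℤ}
    {z : ULift.{u} (I × I)} (hz : z ∈ shiftedCell N k i j) :
    shiftedCell N k i j ⊆ Metric.ball z δ := by
  intro w hw
  rw [Metric.mem_ball, ULift.dist_eq, Prod.dist_eq, max_lt_iff, Subtype.dist_eq, Subtype.dist_eq,
    Real.dist_eq, Real.dist_eq]
  exact ⟨abs_sub_lt_of_mem_Ioo hδ hw.1 hz.1, abs_sub_lt_of_mem_Ioo hδ hw.2 hz.2⟩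

theorem eq_floor_of_mem_shiftedCell {N : ℕ} {k : Fin 3} {i j : ℤ} {z : ULift.{u} (I × I)}
    (hz : z ∈ shiftedCell N k i j) :
    i = ⌊(N : ℝ) * z.down.1 - (k : ℕ) / 3⌋ ∧ j = ⌊(N : ℝ) * z.down.2 - (k : ℕ) / 3⌋ :=
  ⟨(Int.floor_eq_iff.2 ⟨hz.1.1.le, hz.1.2⟩).symm, (Int.floor_eq_iff.2 ⟨hz.2.1.le, hz.2.2⟩).symm⟩

/-- Two distinct thirds in `[0, 1)` do not differ by an integer. -/
theorem fin_three_eq_of_sub_div_eq_int {a : ℝ} {k l : Fin 3} {m n : ℤ}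
    (hk : a - (k : ℕ) / 3 = m) (hl : a - (l : ℕ) / 3 = n) : k = l := by
  have h : ((k : ℕ) : ℝ) + 3 * m = (l : ℕ) + 3 * n := by linarith
  have h' : ((k : ℕ) : ℤ) + 3 * m = (l : ℕ) + 3 * n := by exact_mod_cast h
  omega

theorem exists_fin_three_not_and_not {P Q : Fin 3 → Prop} (hP : ∀ k l, P k → P l → k = l)
    (hQ : ∀ k l, Q k → Q l → k = l) : ∃ k, ¬ P k ∧ ¬ Q k := by
  have p01 := hP 0 1
  have p02 := hP 0 2
  have p12 := hP 1 2
  have q01 := hQ 0 1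
  have q02 := hQ 0 2
  have q12 := hQ 1 2
  by_contra! H
  have h0 := H 0
  have h1 := H 1
  have h2 := H 2
  simp only [Fin.reduceEq] at p01 p02 p12 q01 q02 q12
  tauto

theorem exists_fin_three_forall_ne_int (a b : ℝ) :
    ∃ k : Fin 3, (∀ m : ℤ, a - (k : ℕ) / 3 ≠ m) ∧ ∀ m : ℤ, b - (k : ℕ) / 3 ≠ m := by
  have key (c : ℝ) (k l : Fin 3) : (∃ m : ℤ, c - (k : ℕ) / 3 = m) →
      (∃ m : ℤ, c - (l : ℕ) / 3 = m) → k = l :=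
    fun ⟨_, hm⟩ ⟨_, hn⟩ => fin_three_eq_of_sub_div_eq_int hm hn
  obtain ⟨k, ha, hb⟩ := exists_fin_three_not_and_not (key a) (key b)
  exact ⟨k, not_exists.1 ha, not_exists.1 hb⟩

theorem mem_Ioo_floor {a : ℝ} (ha : ∀ m : ℤ, a ≠ m) : a ∈ Set.Ioo (⌊a⌋ : ℝ) (⌊a⌋ + 1) :=
  ⟨lt_of_le_of_ne (Int.floor_le a) (ha _).symm, Int.lt_floor_add_one a⟩

theorem floor_mem_Icc (N : ℕ) (k : Fin 3) (t : I) :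
    ⌊(N : ℝ) * t - (k : ℕ) / 3⌋ ∈ Finset.Icc (-1 : ℤ) N := by
  have hk : ((k : ℕ) : ℝ) ≤ 2 := by exact_mod_cast Nat.le_of_lt_succ k.2
  have hk' : (0 : ℝ) ≤ (k : ℕ) := Nat.cast_nonneg _
  have h₀ : 0 ≤ (N : ℝ) * t := mul_nonneg (Nat.cast_nonneg N) t.2.1
  have h₁ : (N : ℝ) * t ≤ N := mul_le_of_le_one_right (Nat.cast_nonneg N) t.2.2
  rw [Finset.mem_Icc]
  constructor
  · rw [Int.le_floor]
    push_cast
    linarith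
  · refine Int.floor_le_iff.2 ?_
    push_cast
    linarith

/-- The unit square has covering dimension at most two. -/
theorem covDimLE_square : CovDimLE (ULift.{u} (I × I)) 2 := by
  classical
  intro 𝒰 hopen hcover
  obtain ⟨δ, hδ, hball⟩ := lebesgue_number_lemma_of_metric_sUnion
    (isCompact_univ (X := ULift.{u} (I × I))) hopen hcover.ge
  obtain ⟨N, hN⟩ := exists_nat_gt (1 / δ)
  rw [div_lt_iff₀ hδ] at hN
  refine ⟨(Finset.univ ×ˢ Finset.Icc (-1 : ℤ) N ×ˢ Finset.Icc (-1 : ℤ) N).image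
    fun p => shiftedCell N p.1 p.2.1 p.2.2, ?_, ?_, ?_, ?_⟩
  · intro V hV
    obtain ⟨p, -, rfl⟩ := Finset.mem_image.1 hV
    exact isOpen_shiftedCell ..
  · refine Set.eq_univ_of_forall fun z => ?_
    obtain ⟨k, h₁, h₂⟩ := exists_fin_three_forall_ne_int (N * z.down.1) (N * z.down.2)
    exact ⟨_, Finset.mem_coe.2 (Finset.mem_image_of_mem _ (a := (k, _, _)) (Finset.mk_mem_product
      (Finset.mem_univ k) (Finset.mk_mem_product (floor_mem_Icc N k z.down.1)
        (floor_mem_Icc N k z.down.2)))), mem_Ioo_floor h₁, mem_Ioo_floor h₂⟩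
  · intro V hV
    obtain ⟨p, -, rfl⟩ := Finset.mem_image.1 hV
    rcases (shiftedCell.{u} N p.1 p.2.1 p.2.2).eq_empty_or_nonempty with he | ⟨z, hz⟩
    · obtain ⟨U, hU, -⟩ := hball ⟨0, 0⟩ (Set.mem_univ _)
      exact ⟨U, hU, he ▸ Set.empty_subset U⟩
    · obtain ⟨U, hU, hzU⟩ := hball z (Set.mem_univ _)
      exact ⟨U, hU, (shiftedCell_subset_ball hN hz).trans hzU⟩
  · intro z
    have hex : ∀ V : {V : Set (ULift.{u} (I × I)) // V ∈ (Finset.univ ×ˢ Finset.Icc (-1 : ℤ) N ×ˢ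
        Finset.Icc (-1 : ℤ) N).image (fun p => shiftedCell N p.1 p.2.1 p.2.2) ∧ z ∈ V},
        ∃ k : Fin 3, V.1 = shiftedCell N k ⌊(N : ℝ) * z.down.1 - (k : ℕ) / 3⌋
          ⌊(N : ℝ) * z.down.2 - (k : ℕ) / 3⌋ := by
      rintro ⟨V, hV, hz⟩
      obtain ⟨p, -, rfl⟩ := Finset.mem_image.1 hV
      obtain ⟨hi, hj⟩ := eq_floor_of_mem_shiftedCell hz
      exact ⟨p.1, by rw [← hi, ← hj]⟩
    choose f hf using hex
    have hinj : Function.Injective f := fun V W h =>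
      Subtype.ext (by rw [hf V, hf W, h])
    simpa using Nat.card_le_card_of_injective f hinj

/-- Partial maps from closed subsets of the unit square to an AE(2)-space extend. -/
theorem IsAE.exists_extension_square {X : Type u} [TopologicalSpace X] (h : IsAE 2 X)
    {K : Set (I × I)} (hK : IsClosed K) {f : I × I → X} (hf : ContinuousOn f K) :
    ∃ F : C(I × I, X), Set.EqOn F f K := by
  have hc : Continuous fun z : ULift.down.{u} ⁻¹' K => f z.1.down :=
    hf.comp_continuous (by fun_prop) fun z => z.2
  obtain ⟨g, hg⟩ := h (ULift.{u} (I × I)) inferInstance inferInstance covDimLE_square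
    (ULift.down ⁻¹' K) (hK.preimage continuous_uliftDown) ⟨_, hc⟩
  exact ⟨g.comp ⟨ULift.up, continuous_uliftUp⟩, fun z hz => hg ⟨ULift.up z, hz⟩⟩

theorem continuousOn_ite_fst_eq_zero {X : Type*} [TopologicalSpace X] {p q : I → X}
    (hp : Continuous p) (hq : Continuous q) :
    ContinuousOn (fun z : I × I => if z.1 = 0 then p z.2 else q z.2)
      ({z | z.1 = 0} ∪ {z | z.1 = 1}) := by
  refine ContinuousOn.union_of_isClosed ?_ ?_ (isClosed_eq continuous_fst continuous_const)
    (isClosed_eq continuous_fst continuous_const)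
  · exact (hp.comp continuous_snd).continuousOn.congr fun z hz => if_pos hz
  · refine (hq.comp continuous_snd).continuousOn.congr fun z hz => if_neg ?_
    rw [Set.mem_ofPred_eq] at hz
    simp [hz]

theorem IsAE.joined {X : Type u} [TopologicalSpace X] (h : IsAE 2 X) (x y : X) :
    Joined x y := by
  obtain ⟨F, hF⟩ := h.exists_extension_square
    ((isClosed_eq continuous_fst continuous_const).union
      (isClosed_eq continuous_fst continuous_const))
    (continuousOn_ite_fst_eq_zero (continuous_const (y := x)) (continuous_const (y := y)))
  refine ⟨⟨⟨fun t => F (t, 0), by fun_prop⟩, ?_, ?_⟩⟩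
  · exact (hF (.inl rfl)).trans (if_pos rfl)
  · exact (hF (.inr rfl)).trans (if_neg one_ne_zero)

theorem IsAE.path_homotopic {X : Type u} [TopologicalSpace X] (h : IsAE 2 X) {x y : X}
    (p q : Path x y) : p.Homotopic q := by
  have hK (c : I) : IsClosed {z : I × I | z.1 = c} := isClosed_eq continuous_fst continuous_const
  have hL (c : I) : IsClosed {z : I × I | z.2 = c} := isClosed_eq continuous_snd continuous_const
  have hx : ContinuousOn (fun z : I × I => if z.1 = 0 then p z.2 else q z.2) {z | z.2 = 0} :=
    (continuousOn_const (c := x)).congr fun z hz => by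
      rw [Set.mem_ofPred_eq] at hz
      simp [hz]
  have hy : ContinuousOn (fun z : I × I => if z.1 = 0 then p z.2 else q z.2) {z | z.2 = 1} :=
    (continuousOn_const (c := y)).congr fun z hz => by
      rw [Set.mem_ofPred_eq] at hz
      simp [hz]
  obtain ⟨F, hF⟩ := h.exists_extension_square
    (((hK 0).union (hK 1)).union ((hL 0).union (hL 1)))
    ((continuousOn_ite_fst_eq_zero p.continuous q.continuous).union_of_isClosed
      (hx.union_of_isClosed hy (hL 0) (hL 1)) ((hK 0).union (hK 1)) ((hL 0).union (hL 1)))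
  refine ⟨⟨⟨F, fun t => ?_, fun t => ?_⟩, fun t s hs => ?_⟩⟩
  · exact (hF (.inl (.inl rfl))).trans (if_pos rfl)
  · exact (hF (.inl (.inr rfl))).trans (if_neg one_ne_zero)
  · rcases hs with rfl | rfl
    · exact (hF (.inr (.inl rfl))).trans (by simp)
    · exact (hF (.inr (.inr rfl))).trans (by simp)

/-- Every nonempty compact Hausdorff AE(2)-compactum is simply connected, i.e.
path-connected with trivial fundamental group. -/
theorem simplyConnected_of_AE2 (X : Type u) [TopologicalSpace X] [CompactSpace X]
    [T2Space X] [Nonempty X] (h : IsAE 2 X) :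
    PathConnectedSpace X ∧ ∀ x : X, Subsingleton (FundamentalGroup X x) := by
  have hpc : PathConnectedSpace X := ⟨inferInstance, h.joined⟩
  have : SimplyConnectedSpace X :=
    simply_connected_iff_paths_homotopic'.2 ⟨hpc, fun p q => h.path_homotopic p q⟩
  exact ⟨hpc, fun x => inferInstance⟩
end
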